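/- Let X = λ₁T + λ₂Q + λ₃n be a non-isotropic vector field along α (λ₁ nowhere zero) with λ₁, λ₂, λ₃ : ℝ → ℝ smooth. Then X is Fermi–Walker transported along α (∇̃_T X = 0 identically) if and only if λ₁ is constant and there exist constants c₁, c₂ such that λ₂(x) = c₁ cos(∫₁ˣ τ_g(t) dt) + c₂ sin(∫₁ˣ τ_g(t) dt) and λ₃(x) = c₂ cos(∫₁ˣ τ_g(t) dt) − c₁ sin(∫₁ˣ τ_g(t) dt) for all x. -/

import Mathlib

/-- The Galilean scalar product on `ℝ³`: `v₁w₁` if `v₁ ≠ 0` or `w₁ ≠ 0`,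
and `v₂w₂ + v₃w₃` if `v₁ = 0` and `w₁ = 0`. -/
noncomputable def gProd (v w : Fin 3 → ℝ) : ℝ :=
  if v 0 ≠ 0 ∨ w 0 ≠ 0 then v 0 * w 0 else v 1 * w 1 + v 2 * w 2

/-- The admissible curve `α(x) = (x, y(x), z(x))` in Galilean 3-space. -/
noncomputable def curve (y z : ℝ → ℝ) : ℝ → Fin 3 → ℝ :=
  fun x => ![x, y x, z x]

/-- The Fermi–Walker derivative along `α = curve y z`:
`∇̃_T X = X' − ⟨T,X⟩A + ⟨A,X⟩T`, where `T = α'` and `A = T' = α''`. -/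
noncomputable def FW (y z : ℝ → ℝ) (X : ℝ → Fin 3 → ℝ) (x : ℝ) : Fin 3 → ℝ :=
  deriv X x
    - gProd (deriv (curve y z) x) (X x) • deriv (deriv (curve y z)) x
    + gProd (deriv (deriv (curve y z)) x) (X x) • deriv (curve y z) x

/-- The tangent `T = α' = (1, y', z')`. -/
noncomputable def Tvec (y z : ℝ → ℝ) (x : ℝ) : Fin 3 → ℝ :=
  ![1, deriv y x, deriv z x]

/-- The curvature `κ = √(y''² + z''²)`. -/
noncomputable def kappa (y z : ℝ → ℝ) (x : ℝ) : ℝ :=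
  Real.sqrt (deriv (deriv y) x ^ 2 + deriv (deriv z) x ^ 2)

/-- The principal normal `N = (1/κ)(0, y'', z'')`. -/
noncomputable def Nvec (y z : ℝ → ℝ) (x : ℝ) : Fin 3 → ℝ :=
  (kappa y z x)⁻¹ • ![0, deriv (deriv y) x, deriv (deriv z) x]

/-- The binormal `B = (1/κ)(0, −z'', y'')`. -/
noncomputable def Bvec (y z : ℝ → ℝ) (x : ℝ) : Fin 3 → ℝ :=
  (kappa y z x)⁻¹ • ![0, -deriv (deriv z) x, deriv (deriv y) x]

/-- The torsion `τ = det(α', α'', α''') / κ²`. -/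
noncomputable def tors (y z : ℝ → ℝ) (x : ℝ) : ℝ :=
  (Matrix.of ![![(1 : ℝ), deriv y x, deriv z x],
    ![0, deriv (deriv y) x, deriv (deriv z) x],
    ![0, deriv (deriv (deriv y)) x, deriv (deriv (deriv z)) x]]).det / kappa y z x ^ 2

/-- The expansion of a plane vector in an orthonormal basis. -/
theorem plane_expansion {a b c d : ℝ} (hab : a ^ 2 + b ^ 2 = 1) (hcd : c ^ 2 + d ^ 2 = 1)
    (h : a * c + b * d = 0) (u v : ℝ) :
    u = (u * a + v * b) * a + (u * c + v * d) * c ∧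
      v = (u * a + v * b) * b + (u * c + v * d) * d := by
  obtain ⟨e, hc, hd⟩ : ∃ e : ℝ, c = -e * b ∧ d = e * a :=
    ⟨a * d - b * c, by linear_combination -c * hab + a * h, by linear_combination -d * hab + b * h⟩
  subst hc hd
  have he : e ^ 2 = 1 := by linear_combination hcd - e ^ 2 * hab
  constructor
  · linear_combination -u * hab - (u * b - v * a) * b * he
  · linear_combination -v * hab - (v * a - u * b) * a * he

/-- The Frenet-type equations of a moving orthonormal frame of the plane. -/
theorem plane_frame_deriv {a b c d : ℝ → ℝ} {a' b' c' d' x : ℝ}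
    (ha : HasDerivAt a a' x) (hb : HasDerivAt b b' x)
    (hc : HasDerivAt c c' x) (hd : HasDerivAt d d' x)
    (hab : ∀ t, a t ^ 2 + b t ^ 2 = 1) (hcd : ∀ t, c t ^ 2 + d t ^ 2 = 1)
    (h : ∀ t, a t * c t + b t * d t = 0) :
    (a' = (a' * c x + b' * d x) * c x ∧ b' = (a' * c x + b' * d x) * d x) ∧
      c' = -(a' * c x + b' * d x) * a x ∧ d' = -(a' * c x + b' * d x) * b x := by
  have const_deriv : ∀ {f : ℝ → ℝ} {f' k : ℝ}, HasDerivAt f f' x → (∀ t, f t = k) → f' = 0 := by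
    intro f f' k hf hk
    obtain rfl : f = fun _ => k := funext hk
    exact hf.unique (hasDerivAt_const x k)
  have h1 := const_deriv ((ha.pow 2).add (hb.pow 2)) hab
  have h2 := const_deriv ((hc.pow 2).add (hd.pow 2)) hcd
  have h3 := const_deriv ((ha.mul hc).add (hb.mul hd)) h
  norm_num at h1 h2
  obtain ⟨e1, e2⟩ := plane_expansion (hab x) (hcd x) (h x) a' b'
  obtain ⟨e3, e4⟩ := plane_expansion (hab x) (hcd x) (h x) c' d'
  refine ⟨⟨?_, ?_⟩, ?_, ?_⟩
  · linear_combination e1 + a x / 2 * h1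
  · linear_combination e2 + b x / 2 * h1
  · linear_combination e3 + c x / 2 * h2 + a x * h3
  · linear_combination e4 + d x / 2 * h2 + b x * h3

/-- Solutions of the rotation system `f' = τ g`, `g' = -τ f`. -/
theorem rotation_system_iff {f g τ : ℝ → ℝ} (hτ : Continuous τ)
    (hf : Differentiable ℝ f) (hg : Differentiable ℝ g) (x₀ : ℝ) :
    (∀ x, deriv f x = τ x * g x ∧ deriv g x = -τ x * f x) ↔
      ∃ c₁ c₂ : ℝ, ∀ x : ℝ,
        f x = c₁ * Real.cos (∫ t in x₀..x, τ t) + c₂ * Real.sin (∫ t in x₀..x, τ t) ∧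
        g x = c₂ * Real.cos (∫ t in x₀..x, τ t) - c₁ * Real.sin (∫ t in x₀..x, τ t) := by
  have hθ : ∀ x, HasDerivAt (fun x => ∫ t in x₀..x, τ t) (τ x) x := fun x =>
    hτ.integral_hasStrictDerivAt x₀ x |>.hasDerivAt
  change _ ↔ ∃ c₁ c₂ : ℝ, ∀ x : ℝ,
    f x = c₁ * Real.cos ((fun x => ∫ t in x₀..x, τ t) x) +
        c₂ * Real.sin ((fun x => ∫ t in x₀..x, τ t) x) ∧
      g x = c₂ * Real.cos ((fun x => ∫ t in x₀..x, τ t) x) -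
        c₁ * Real.sin ((fun x => ∫ t in x₀..x, τ t) x)
  generalize (fun x => ∫ t in x₀..x, τ t) = θ at hθ ⊢
  constructor
  · intro h
    have hP : ∀ x, HasDerivAt (fun x => f x * Real.cos (θ x) - g x * Real.sin (θ x)) 0 x := by
      intro x
      refine (((hf x).hasDerivAt.mul (hθ x).cos).sub
        ((hg x).hasDerivAt.mul (hθ x).sin)).congr_deriv ?_
      rw [(h x).1, (h x).2]
      ring
    have hR : ∀ x, HasDerivAt (fun x => f x * Real.sin (θ x) + g x * Real.cos (θ x)) 0 x := by
      intro x
      refine (((hf x).hasDerivAt.mul (hθ x).sin).add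
        ((hg x).hasDerivAt.mul (hθ x).cos)).congr_deriv ?_
      rw [(h x).1, (h x).2]
      ring
    refine ⟨f x₀ * Real.cos (θ x₀) - g x₀ * Real.sin (θ x₀),
      f x₀ * Real.sin (θ x₀) + g x₀ * Real.cos (θ x₀), fun x => ?_⟩
    have e1 := is_const_of_deriv_eq_zero (fun t => (hP t).differentiableAt)
      (fun t => (hP t).deriv) x x₀
    have e2 := is_const_of_deriv_eq_zero (fun t => (hR t).differentiableAt)
      (fun t => (hR t).deriv) x x₀
    rw [← e1, ← e2]
    have hcs := Real.sin_sq_add_cos_sq (θ x)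
    constructor
    · linear_combination -f x * hcs
    · linear_combination -g x * hcs
  · rintro ⟨c₁, c₂, h⟩ x
    have e1 : f = fun x => c₁ * Real.cos (θ x) + c₂ * Real.sin (θ x) := funext fun x => (h x).1
    have e2 : g = fun x => c₂ * Real.cos (θ x) - c₁ * Real.sin (θ x) := funext fun x => (h x).2
    have d1 := (((hθ x).cos.const_mul c₁).add ((hθ x).sin.const_mul c₂)).deriv
    have d2 := (((hθ x).cos.const_mul c₂).sub ((hθ x).sin.const_mul c₁)).deriv
    rw [e1, e2]
    constructor
    · refine d1.trans ?_
      ring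
    · refine d2.trans ?_
      ring

theorem hasDerivAt_vec3 {f g h : ℝ → ℝ} {f' g' h' x : ℝ} (hf : HasDerivAt f f' x)
    (hg : HasDerivAt g g' x) (hh : HasDerivAt h h' x) :
    HasDerivAt (fun t => ![f t, g t, h t]) ![f', g', h'] x := by
  rw [hasDerivAt_pi]
  intro i
  fin_cases i <;> simpa

theorem deriv_curve {y z : ℝ → ℝ} (hy : Differentiable ℝ y) (hz : Differentiable ℝ z) :
    deriv (curve y z) = Tvec y z :=
  funext fun x => (hasDerivAt_vec3 (hasDerivAt_id x) (hy x).hasDerivAt (hz x).hasDerivAt).deriv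

theorem hasDerivAt_Tvec {y z : ℝ → ℝ} (hy : Differentiable ℝ (deriv y))
    (hz : Differentiable ℝ (deriv z)) (x : ℝ) :
    HasDerivAt (Tvec y z) ![0, deriv (deriv y) x, deriv (deriv z) x] x :=
  hasDerivAt_vec3 (hasDerivAt_const x 1) (hy x).hasDerivAt (hz x).hasDerivAt

/-- For a non-isotropic `X = lT + V` with `V` isotropic, the Fermi–Walker derivative is
`l'T + V'`. -/
theorem FW_nonisotropic {y z : ℝ → ℝ} (hy : Differentiable ℝ y) (hz : Differentiable ℝ z)
    (hy' : Differentiable ℝ (deriv y)) (hz' : Differentiable ℝ (deriv z))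
    {l : ℝ → ℝ} {V : ℝ → Fin 3 → ℝ} {l' x : ℝ} {V' : Fin 3 → ℝ}
    (hl : HasDerivAt l l' x) (hV : HasDerivAt V V' x) (hlx : l x ≠ 0) (hV0 : V x 0 = 0) :
    FW y z (fun t => l t • Tvec y z t + V t) x = l' • Tvec y z x + V' := by
  have hT := hasDerivAt_Tvec hy' hz' x
  have hT0 : Tvec y z x 0 = 1 := rfl
  have hX := ((hl.smul hT).add hV).deriv
  unfold FW
  rw [deriv_curve hy hz, hT.deriv]
  simp only [gProd, Pi.add_apply, Pi.smul_apply, smul_eq_mul, hT0, hV0, Matrix.cons_val_zero]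
  simp only [mul_one, add_zero, ne_eq, one_ne_zero, not_false_eq_true, hlx, or_true,
    if_true, one_mul, zero_mul, zero_smul]
  refine (congrArg (· - _) hX).trans ?_
  abel

/-- a non-isotropic field `X = λ₁T + λ₂Q + λ₃n` (with `λ₁` nowhere zero)
is Fermi–Walker transported iff `λ₁` is constant and `λ₂, λ₃` are the stated
cosine/sine combinations of `∫₁ˣ τ_g`. -/
theorem fermiWalker_transported_nonisotropic_darboux_iff
(y z : ℝ → ℝ) (hy : ContDiff ℝ (⊤ : ℕ∞) y) (hz : ContDiff ℝ (⊤ : ℕ∞) z)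
    (Q n : ℝ → Fin 3 → ℝ) (hQ : ContDiff ℝ (⊤ : ℕ∞) Q) (hn : ContDiff ℝ (⊤ : ℕ∞) n)
    (hQiso : ∀ x, Q x 0 = 0) (hniso : ∀ x, n x 0 = 0)
    (hQQ : ∀ x, Q x 1 ^ 2 + Q x 2 ^ 2 = 1)
    (hnn : ∀ x, n x 1 ^ 2 + n x 2 ^ 2 = 1)
    (hQn : ∀ x, Q x 1 * n x 1 + Q x 2 * n x 2 = 0)
(kg kn : ℝ → ℝ)
    (hkg : ∀ x, kg x = gProd (deriv (deriv (curve y z)) x) (Q x))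
    (hkn : ∀ x, kn x = gProd (deriv (deriv (curve y z)) x) (n x))
(tg : ℝ → ℝ) (htg : ∀ x, tg x = gProd (deriv Q x) (n x))
    (lam₁ lam₂ lam₃ : ℝ → ℝ)
    (h₁ : ContDiff ℝ (⊤ : ℕ∞) lam₁) (h₂ : ContDiff ℝ (⊤ : ℕ∞) lam₂) (h₃ : ContDiff ℝ (⊤ : ℕ∞) lam₃)
    (hlam₁ : ∀ x, lam₁ x ≠ 0)
    (X : ℝ → Fin 3 → ℝ)
    (hX : ∀ x, X x = lam₁ x • Tvec y z x + lam₂ x • Q x + lam₃ x • n x) :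
    (∀ x : ℝ, FW y z X x = 0) ↔
      ((∃ c : ℝ, ∀ x, lam₁ x = c) ∧ ∃ c₁ c₂ : ℝ, ∀ x : ℝ,
        lam₂ x = c₁ * Real.cos (∫ t in (1:ℝ)..x, tg t)
               + c₂ * Real.sin (∫ t in (1:ℝ)..x, tg t) ∧
        lam₃ x = c₂ * Real.cos (∫ t in (1:ℝ)..x, tg t)
               - c₁ * Real.sin (∫ t in (1:ℝ)..x, tg t)) := by
  have diff : ∀ {f : ℝ → ℝ}, ContDiff ℝ (⊤ : ℕ∞) f →
      Differentiable ℝ f := fun h => h.differentiable (by simp)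
  have dy := (contDiff_infty_iff_deriv.1 hy).2
  have dz := (contDiff_infty_iff_deriv.1 hz).2
  have dQ : ∀ x, HasDerivAt Q (deriv Q x) x :=
    fun x => (hQ.differentiable (by simp) x).hasDerivAt
  have dn : ∀ x, HasDerivAt n (deriv n x) x :=
    fun x => (hn.differentiable (by simp) x).hasDerivAt
  have dQi := fun x => hasDerivAt_pi.1 (dQ x)
  have dni := fun x => hasDerivAt_pi.1 (dn x)
  have dQ0 : ∀ x, deriv Q x 0 = 0 := fun x => by
    have h := dQi x 0
    simp only [hQiso] at h
    exact h.unique (hasDerivAt_const x 0)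
  have dn0 : ∀ x, deriv n x 0 = 0 := fun x => by
    have h := dni x 0
    simp only [hniso] at h
    exact h.unique (hasDerivAt_const x 0)
  have htg' : ∀ x, tg x = deriv Q x 1 * n x 1 + deriv Q x 2 * n x 2 := fun x => by
    simp [htg, gProd, dQ0, hniso]
  have hframe : ∀ x, deriv Q x = tg x • n x ∧ deriv n x = -tg x • Q x := fun x => by
    obtain ⟨⟨e1, e2⟩, e3, e4⟩ :=
      plane_frame_deriv (dQi x 1) (dQi x 2) (dni x 1) (dni x 2) hQQ hnn hQn
    rw [← htg'] at e1 e2 e3 e4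
    constructor <;> ext i <;> fin_cases i <;> simp_all
  have htgc : Continuous tg := by
    have hQ' : Continuous (deriv Q) := (contDiff_infty_iff_deriv.1 hQ).2.continuous
    have hnc := hn.continuous
    rw [funext htg']
    fun_prop
  have hFW : ∀ x, FW y z X x = deriv lam₁ x • Tvec y z x +
      ((deriv lam₂ x - tg x * lam₃ x) • Q x + (deriv lam₃ x + tg x * lam₂ x) • n x) := fun x => by
    have hX' : X = fun t => lam₁ t • Tvec y z t + (lam₂ • Q + lam₃ • n) t :=
      funext fun t => (hX t).trans (add_assoc _ _ _)
    rw [hX', FW_nonisotropic (diff hy) (diff hz) (diff dy) (diff dz) (diff h₁ x).hasDerivAt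
      (((diff h₂ x).hasDerivAt.smul (dQ x)).add ((diff h₃ x).hasDerivAt.smul (dn x)))
      (hlam₁ x) (by simp [hQiso, hniso]), (hframe x).1, (hframe x).2]
    module
  have hiff : ∀ x, FW y z X x = 0 ↔ deriv lam₁ x = 0 ∧
      deriv lam₂ x = tg x * lam₃ x ∧ deriv lam₃ x = -tg x * lam₂ x := fun x => by
    rw [hFW]
    constructor
    · intro h
      have e0 : deriv lam₁ x = 0 := by
        simpa [Tvec, hQiso, hniso] using congrFun h 0
      have e1 := congrFun h 1
      have e2 := congrFun h 2
      simp only [e0, zero_smul, zero_add, Pi.add_apply, Pi.smul_apply, smul_eq_mul,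
        Pi.zero_apply] at e1 e2
      refine ⟨e0, ?_, ?_⟩
      · linear_combination Q x 1 * e1 + Q x 2 * e2 - (deriv lam₂ x - tg x * lam₃ x) * hQQ x -
          (deriv lam₃ x + tg x * lam₂ x) * hQn x
      · linear_combination n x 1 * e1 + n x 2 * e2 - (deriv lam₂ x - tg x * lam₃ x) * hQn x -
          (deriv lam₃ x + tg x * lam₂ x) * hnn x
    · rintro ⟨e0, e1, e2⟩
      simp [e0, e1, e2]
  simp only [hiff, forall_and (p := fun x => deriv lam₁ x = 0)]
  refine and_congr ⟨fun h => ⟨lam₁ 1, fun x => is_const_of_deriv_eq_zero (diff h₁) h x 1⟩, ?_⟩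
    (rotation_system_iff htgc (diff h₂) (diff h₃) 1)
  rintro ⟨c, hc⟩ x
  rw [funext hc, deriv_const]
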